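/- arXiv:2107.04977 — 5 statements merged into one kernel-verified Lean document; each statement's English description precedes it below -/
import Mathlib

section
/- Let 0 < ε < 1 and 0 < β < 1, and set N* = ⌈ (1/ε) · (e/(e−1)) · (1 + ln(1/β)) ⌉, where e is Euler's number. Then (1−ε)^{N*−1} (1 − ε + N* ε) ≤ β. -/
/-- The first two terms of the binomial expansion bound the full power from below. -/
lemma pow_mul_add_succ_mul_le_add_pow {x y : ℝ} (hx : 0 ≤ x) (hy : 0 ≤ y) (n : ℕ) :
    x ^ n * (x + (n + 1) * y) ≤ (x + y) ^ (n + 1) := by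
  induction n with
  | zero => simp
  | succ n ih =>
    calc x ^ (n + 1) * (x + ((n + 1 : ℕ) + 1) * y)
        ≤ x ^ n * (x + (n + 1) * y) * (x + y) := by
          have h : 0 ≤ x ^ n * ((n + 1) * y ^ 2) := by positivity
          push_cast
          linear_combination h
      _ ≤ (x + y) ^ (n + 1) * (x + y) := by gcongr
      _ = (x + y) ^ (n + 1 + 1) := (pow_succ _ _).symm

/-- Chernoff bound for the probability that a binomial variable is at most one. -/
lemma one_sub_pow_mul_le_exp {ε : ℝ} (hε0 : 0 ≤ ε) (hε1 : ε ≤ 1) (n : ℕ) :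
    (1 - ε) ^ n * (1 - ε + (n + 1) * ε) ≤
      Real.exp (1 - (n + 1) * (ε * (1 - Real.exp (-1)))) := by
  have hx : 0 ≤ 1 - ε := sub_nonneg.2 hε1
  have he : Real.exp 1 * Real.exp (-1) = 1 := by rw [← Real.exp_add]; simp
  calc (1 - ε) ^ n * (1 - ε + (n + 1) * ε)
      ≤ (1 - ε) ^ n * (Real.exp 1 * (1 - ε) + (n + 1) * ε) := by
        gcongr
        exact le_mul_of_one_le_left hx (Real.one_le_exp zero_le_one)
    _ = Real.exp 1 * ((1 - ε) ^ n * (1 - ε + (n + 1) * (ε * Real.exp (-1)))) := by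
        linear_combination -(1 - ε) ^ n * (n + 1) * ε * he
    _ ≤ Real.exp 1 * (1 - ε + ε * Real.exp (-1)) ^ (n + 1) := by
        gcongr
        exact pow_mul_add_succ_mul_le_add_pow hx (by positivity) n
    _ ≤ Real.exp 1 * Real.exp (-(ε * (1 - Real.exp (-1)))) ^ (n + 1) := by
        gcongr
        linarith [Real.add_one_le_exp (-(ε * (1 - Real.exp (-1))))]
    _ = Real.exp (1 - (n + 1) * (ε * (1 - Real.exp (-1)))) := by
        rw [← Real.exp_nat_mul, ← Real.exp_add]
        push_cast
        ring_nf

theorem margellos_bound_one_dim {ε β : ℝ} (hε0 : 0 < ε) (hε1 : ε < 1)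
    (hβ0 : 0 < β) (hβ1 : β < 1) (Nstar : ℕ)
    (hNstar : Nstar =
      ⌈(1 / ε) * (Real.exp 1 / (Real.exp 1 - 1)) * (1 + Real.log (1 / β))⌉₊) :
    (1 - ε) ^ (Nstar - 1) * (1 - ε + (Nstar : ℝ) * ε) ≤ β := by
  have he : 0 < Real.exp 1 - 1 := sub_pos.2 (Real.one_lt_exp_iff.2 one_pos)
  have hlog : 0 < 1 + Real.log (1 / β) := by
    have := Real.log_pos ((one_lt_div hβ0).2 hβ1)
    linarith
  have hN := Nat.le_ceil ((1 / ε) * (Real.exp 1 / (Real.exp 1 - 1)) * (1 + Real.log (1 / β)))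
  have hpos : 0 < Nstar := hNstar ▸ Nat.ceil_pos.2 (by positivity)
  rw [← hNstar] at hN
  obtain ⟨n, rfl⟩ := Nat.exists_eq_add_one.2 hpos
  push_cast at hN ⊢
  have hc : 0 < ε * (1 - Real.exp (-1)) :=
    mul_pos hε0 (sub_pos.2 (Real.exp_lt_one_iff.2 (by norm_num)))
  have hmul : 1 + Real.log (1 / β) ≤ (n + 1) * (ε * (1 - Real.exp (-1))) := by
    calc 1 + Real.log (1 / β)
        = (1 / ε) * (Real.exp 1 / (Real.exp 1 - 1)) * (1 + Real.log (1 / β)) *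
            (ε * (1 - Real.exp (-1))) := by
          rw [Real.exp_neg]
          field_simp
      _ ≤ (n + 1) * (ε * (1 - Real.exp (-1))) := by gcongr
  calc (1 - ε) ^ n * (1 - ε + (n + 1) * ε)
      ≤ Real.exp (1 - (n + 1) * (ε * (1 - Real.exp (-1)))) :=
        one_sub_pow_mul_le_exp hε0.le hε1.le n
    _ ≤ Real.exp (Real.log β) := by
        rw [one_div, Real.log_inv] at hmul
        gcongr
        linarith
    _ = β := Real.exp_log hβ0
end

section
/- Let 0 < ε < 1 and 0 < β < 1, set N* = ⌈ (1/ε) · (e/(e−1)) · (1 + ln(1/β)) ⌉, and let N be a natural number with N ≥ (ln β − ln(1 − ε + N* ε)) / ln(1−ε) + 1. Then (1−ε)^{N−1} (1 − ε + N ε) ≤ β. -/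
/-- The first two terms of the binomial expansion bound the whole power from below. -/
theorem pow_mul_add_le_add_pow_succ {x y : ℝ} (hx : 0 ≤ x) (hy : 0 ≤ y) (m : ℕ) :
    x ^ m * (x + ((m : ℝ) + 1) * y) ≤ (x + y) ^ (m + 1) := by
  induction m with
  | zero => simp
  | succ k ih =>
    have h : x ^ k * (x + ((k : ℝ) + 1) * y) * (x + y) ≤ (x + y) ^ (k + 1) * (x + y) :=
      mul_le_mul_of_nonneg_right ih (by positivity)
    have h' : 0 ≤ x ^ k * ((k : ℝ) + 1) * y ^ 2 := by positivity
    rw [pow_succ (x + y) (k + 1)]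
    push_cast
    calc x ^ (k + 1) * (x + ((k : ℝ) + 1 + 1) * y)
        = x ^ k * (x + ((k : ℝ) + 1) * y) * (x + y) - x ^ k * ((k : ℝ) + 1) * y ^ 2 := by ring
      _ ≤ (x + y) ^ (k + 1) * (x + y) := by linarith

/-- The probability of at most one success in `m + 1` independent trials decreases with `m`. -/
theorem antitone_pow_mul_one_sub_add {ε : ℝ} (hε : ε ≤ 1) :
    Antitone fun m : ℕ => (1 - ε) ^ m * (1 - ε + ((m : ℝ) + 1) * ε) := by
  refine antitone_nat_of_succ_le fun m => ?_
  have h : 0 ≤ (1 - ε) ^ m * (((m : ℝ) + 1) * ε ^ 2) :=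
    mul_nonneg (pow_nonneg (by linarith) m) (by positivity)
  push_cast
  calc (1 - ε) ^ (m + 1) * (1 - ε + ((m : ℝ) + 1 + 1) * ε)
      = (1 - ε) ^ m * (1 - ε + ((m : ℝ) + 1) * ε) - (1 - ε) ^ m * (((m : ℝ) + 1) * ε ^ 2) := by
        ring
    _ ≤ (1 - ε) ^ m * (1 - ε + ((m : ℝ) + 1) * ε) := by linarith

/-- Chernoff bound for at most one success in `m + 1` independent trials. -/
theorem pow_mul_one_sub_add_le_exp {ε : ℝ} (hε0 : 0 ≤ ε) (hε1 : ε ≤ 1) (m : ℕ) :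
    (1 - ε) ^ m * (1 - ε + ((m : ℝ) + 1) * ε) ≤
      Real.exp (1 - ((m : ℝ) + 1) * (ε * (1 - (Real.exp 1)⁻¹))) := by
  have hx : 0 ≤ 1 - ε := by linarith
  have he : (1 : ℝ) ≤ Real.exp 1 := Real.one_le_exp zero_le_one
  have hpos : 0 < Real.exp 1 := Real.exp_pos 1
  have hy : 0 ≤ ε * (Real.exp 1)⁻¹ := by positivity
  have hscale : 1 - ε + ((m : ℝ) + 1) * ε ≤
      Real.exp 1 * (1 - ε + ((m : ℝ) + 1) * (ε * (Real.exp 1)⁻¹)) := by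
    have h : Real.exp 1 * (1 - ε + ((m : ℝ) + 1) * (ε * (Real.exp 1)⁻¹)) =
        Real.exp 1 * (1 - ε) + ((m : ℝ) + 1) * ε := by field_simp
    rw [h]
    linarith [le_mul_of_one_le_left hx he]
  calc (1 - ε) ^ m * (1 - ε + ((m : ℝ) + 1) * ε)
      ≤ (1 - ε) ^ m *
          (Real.exp 1 * (1 - ε + ((m : ℝ) + 1) * (ε * (Real.exp 1)⁻¹))) :=
        mul_le_mul_of_nonneg_left hscale (pow_nonneg hx m)
    _ = Real.exp 1 * ((1 - ε) ^ m * (1 - ε + ((m : ℝ) + 1) * (ε * (Real.exp 1)⁻¹))) := by ring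
    _ ≤ Real.exp 1 * (1 - ε + ε * (Real.exp 1)⁻¹) ^ (m + 1) :=
        mul_le_mul_of_nonneg_left (pow_mul_add_le_add_pow_succ hx hy m) hpos.le
    _ ≤ Real.exp 1 * Real.exp (-(ε * (1 - (Real.exp 1)⁻¹))) ^ (m + 1) := by
        gcongr
        linarith [Real.add_one_le_exp (-(ε * (1 - (Real.exp 1)⁻¹)))]
    _ = Real.exp (1 - ((m : ℝ) + 1) * (ε * (1 - (Real.exp 1)⁻¹))) := by
        rw [← Real.exp_nat_mul, ← Real.exp_add]
        push_cast
        ring_nf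

theorem improved_sample_size_suffices {ε β : ℝ} (hε0 : 0 < ε) (hε1 : ε < 1)
    (hβ0 : 0 < β) (hβ1 : β < 1) (Nstar : ℕ)
    (hNstar : Nstar =
      ⌈(1 / ε) * (Real.exp 1 / (Real.exp 1 - 1)) * (1 + Real.log (1 / β))⌉₊)
    (N : ℕ)
    (hN : (Real.log β - Real.log (1 - ε + (Nstar : ℝ) * ε)) / Real.log (1 - ε) + 1 ≤
      (N : ℝ)) :
    (1 - ε) ^ (N - 1) * (1 - ε + (N : ℝ) * ε) ≤ β := by
  have hx : 0 < 1 - ε := by linarith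
  have hlogβ : Real.log β < 0 := Real.log_neg hβ0 hβ1
  have hlogx : Real.log (1 - ε) < 0 := Real.log_neg hx (by linarith)
  have he : 1 < Real.exp 1 := Real.one_lt_exp_iff.mpr one_pos
  have he' : 0 < Real.exp 1 - 1 := by linarith
  have hlog : Real.log (1 / β) = -Real.log β := by rw [one_div, Real.log_inv]
  have hceil := Nat.le_ceil ((1 / ε) * (Real.exp 1 / (Real.exp 1 - 1)) * (1 + Real.log (1 / β)))
  rw [← hNstar, hlog] at hceil
  have hstar_pos : 0 < Nstar := by
    rw [hNstar, Nat.ceil_pos, hlog]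
    have : 0 < 1 + -Real.log β := by linarith
    positivity
  obtain ⟨k, rfl⟩ := Nat.exists_eq_add_of_lt hstar_pos
  rw [zero_add] at hceil hN
  push_cast at hceil hN
  have hA : 1 ≤ 1 - ε + ((k : ℝ) + 1) * ε := by
    have : 0 ≤ (k : ℝ) * ε := by positivity
    linarith
  have hNpos : 0 < N := by
    have h : 0 ≤ (Real.log β - Real.log (1 - ε + ((k : ℝ) + 1) * ε)) / Real.log (1 - ε) :=
      div_nonneg_of_nonpos (by linarith [Real.log_nonneg hA]) hlogx.le
    have : (0 : ℝ) < N := by linarith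
    exact_mod_cast this
  obtain ⟨m, rfl⟩ := Nat.exists_eq_add_of_lt hNpos
  rw [zero_add] at hN ⊢
  push_cast at hN ⊢
  rcases le_total m k with hmk | hkm
  · have hmk' : (m : ℝ) ≤ k := by exact_mod_cast hmk
    have hApos : 0 < 1 - ε + ((k : ℝ) + 1) * ε := by linarith
    have hpow : (1 - ε) ^ m * (1 - ε + ((k : ℝ) + 1) * ε) ≤ β := by
      rw [← Real.log_le_log_iff (by positivity) hβ0,
        Real.log_mul (by positivity) hApos.ne', Real.log_pow]
      have := (div_le_iff_of_neg hlogx).mp (le_of_add_le_add_right hN)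
      linarith
    refine le_trans ?_ hpow
    gcongr
  · calc (1 - ε) ^ m * (1 - ε + ((m : ℝ) + 1) * ε)
        ≤ (1 - ε) ^ k * (1 - ε + ((k : ℝ) + 1) * ε) := antitone_pow_mul_one_sub_add hε1.le hkm
      _ ≤ Real.exp (1 - ((k : ℝ) + 1) * (ε * (1 - (Real.exp 1)⁻¹))) :=
          pow_mul_one_sub_add_le_exp hε0.le hε1.le k
      _ ≤ Real.exp (Real.log β) := by
          have hc : 0 < ε * (1 - (Real.exp 1)⁻¹) :=
            mul_pos hε0 (sub_pos.mpr (inv_lt_one_of_one_lt₀ he))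
          have h := mul_le_mul_of_nonneg_right hceil hc.le
          have heq : 1 / ε * (Real.exp 1 / (Real.exp 1 - 1)) * (1 + -Real.log β) *
              (ε * (1 - (Real.exp 1)⁻¹)) = 1 + -Real.log β := by
            field_simp
          rw [heq] at h
          exact Real.exp_le_exp.mpr (by linarith)
      _ = β := Real.exp_log hβ0
end

section
/- Let 0 < ε < 1 and 0 < β < 1, and set N* = ⌈ (1/ε) · (e/(e−1)) · (1 + ln(1/β)) ⌉. Then the improved sample-size bound does not exceed the existing one: ⌈ (ln β − ln(1 − ε + N* ε)) / ln(1−ε) + 1 ⌉ ≤ N*. -/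
/-- The line through the origin tangent to the graph of `log` lies above the graph. -/
theorem exp_one_mul_log_le {y : ℝ} (hy : 0 < y) : Real.exp 1 * Real.log y ≤ y := by
  have h := Real.log_le_sub_one_of_pos (div_pos hy (Real.exp_pos 1))
  rw [Real.log_div hy.ne' (Real.exp_pos 1).ne', Real.log_exp] at h
  have h' : Real.log y ≤ y / Real.exp 1 := by linarith
  rw [le_div_iff₀ (Real.exp_pos 1)] at h'
  linarith

theorem improved_bound_le_existing {ε β : ℝ} (hε0 : 0 < ε) (hε1 : ε < 1)
    (hβ0 : 0 < β) (hβ1 : β < 1) (Nstar : ℕ)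
    (hNstar : Nstar =
      ⌈(1 / ε) * (Real.exp 1 / (Real.exp 1 - 1)) * (1 + Real.log (1 / β))⌉₊) :
    ⌈(Real.log β - Real.log (1 - ε + (Nstar : ℝ) * ε)) / Real.log (1 - ε) + 1⌉₊ ≤
      Nstar := by
  have ha : 0 < Real.exp 1 - 1 := by linarith [Real.add_one_le_exp (1 : ℝ)]
  have hβ : Real.log β < 0 := Real.log_neg hβ0 hβ1
  have hlog : Real.log (1 - ε) < 0 := Real.log_neg (by linarith) (by linarith)
  have hlog_le : Real.log (1 - ε) ≤ -ε := by
    linarith [Real.log_le_sub_one_of_pos (sub_pos.2 hε1)]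
  rw [one_div β, Real.log_inv] at hNstar
  have hpos : 0 < (1 / ε) * (Real.exp 1 / (Real.exp 1 - 1)) * (1 + -Real.log β) :=
    mul_pos (by positivity) (by linarith)
  have hN : (1 : ℝ) ≤ Nstar := by
    rw [hNstar]
    exact_mod_cast Nat.ceil_pos.2 hpos
  have hle : (1 / ε) * (Real.exp 1 / (Real.exp 1 - 1)) * (1 + -Real.log β) ≤ Nstar :=
    hNstar ▸ Nat.le_ceil _
  have hmul : Real.exp 1 * (1 + -Real.log β) ≤ Nstar * (ε * (Real.exp 1 - 1)) := by
    rw [← div_le_iff₀ (mul_pos hε0 ha)]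
    refine le_of_eq_of_le ?_ hle
    have := ha.ne'
    field_simp
  have hy : 0 < 1 - ε + (Nstar : ℝ) * ε := by
    have : 0 ≤ (Nstar : ℝ) * ε := by positivity
    linarith
  have htangent := exp_one_mul_log_le hy
  have hkey : Real.log (1 - ε + (Nstar : ℝ) * ε) - Real.log β ≤ (Nstar - 1) * ε := by
    refine le_of_mul_le_mul_left ?_ (Real.exp_pos 1)
    nlinarith [mul_pos ha (sub_pos.2 hε1)]
  rw [Nat.ceil_le, ← le_sub_iff_add_le, div_le_iff_of_neg hlog]
  nlinarith [mul_le_mul_of_nonneg_left hlog_le (sub_nonneg.2 hN)]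
end

section
/- Let m ≥ 1, let μ be a Borel probability measure on ℝ^m such that each coordinate marginal (the pushforward of μ under each coordinate projection) is atomless, let 0 < ε < 1 and 0 < β < 1, set N* = ⌈ (m/ε) · (e/(e−1)) · (1 + ln(m/β)) ⌉, and let N ≥ 1 be a natural number with N ≥ (ln β − ln(m − ε + N* ε)) / ln(1 − ε/m) + 1. Then, under the N-fold product measure μ^{⊗N} on (ℝ^m)^N, the probability of the event { (s_1,…,s_N) : μ( { s ∈ ℝ^m : min_{j∈[N]} s_j^i ≤ s^i ≤ max_{j∈[N]} s_j^i for every i ∈ [m] } ) ≥ 1 − ε } is at least 1 − β. -/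
open MeasureTheory

/-- If the complement of a set has probability at most `δ`, the set has probability at least
`1 - δ`; no measurability is needed. -/
theorem ofReal_one_sub_le_of_measure_compl_le {Ω : Type*} [MeasurableSpace Ω] (P : Measure Ω)
    [IsProbabilityMeasure P] {A : Set Ω} {δ : ℝ} (hδ : 0 ≤ δ) (h : P Aᶜ ≤ ENNReal.ofReal δ) :
    ENNReal.ofReal (1 - δ) ≤ P A := by
  rw [ENNReal.ofReal_sub _ hδ, ENNReal.ofReal_one, tsub_le_iff_right]
  calc 1 = P (A ∪ Aᶜ) := by rw [Set.union_compl_self, measure_univ]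
    _ ≤ P A + P Aᶜ := measure_union_le _ _
    _ ≤ P A + ENNReal.ofReal δ := by gcongr

open ProbabilityTheory Set Filter Topology in
/-- The cumulative distribution function of an atomless law is continuous. -/
theorem continuous_cdf_of_nullSingletonClass (ν : Measure ℝ) [IsProbabilityMeasure ν]
    [NullSingletonClass ν] :
    Continuous (cdf ν) := by
  refine continuous_iff_continuousAt.2 fun x => ?_
  have h := (cdf ν).measure_singleton x
  rw [measure_cdf, measure_singleton] at h
  have h1 : cdf ν x - Function.leftLim (cdf ν) x ≤ 0 := ENNReal.ofReal_eq_zero.1 h.symm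
  have h2 : Function.leftLim (cdf ν) x ≤ cdf ν x := (monotone_cdf ν).leftLim_le le_rfl
  rw [(monotone_cdf ν).continuousAt_iff_leftLim_eq_rightLim, StieltjesFunction.rightLim_eq]
  linarith

open ProbabilityTheory Set Filter Topology in
/-- The probability integral transform: the distribution function of an atomless law pushes the
law to the uniform law on `[0, 1]`. -/
theorem map_cdf_of_nullSingletonClass (ν : Measure ℝ) [IsProbabilityMeasure ν]
    [NullSingletonClass ν] :
    ν.map (cdf ν) = volume.restrict (Icc (0 : ℝ) 1) := by
  have hc := continuous_cdf_of_nullSingletonClass ν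
  have hmeas : Measurable (cdf ν) := hc.measurable
  have : IsProbabilityMeasure (ν.map (cdf ν)) :=
    Measure.isProbabilityMeasure_map hmeas.aemeasurable
  refine Measure.ext_of_Iic _ _ fun u => ?_
  rw [Measure.map_apply hmeas measurableSet_Iic, Measure.restrict_apply measurableSet_Iic]
  rcases lt_or_ge u 0 with hu0 | hu0
  · have h1 : cdf ν ⁻¹' Iic u = ∅ := by
      ext x
      simpa using hu0.trans_le (cdf_nonneg ν x)
    have h2 : Iic u ∩ Icc (0 : ℝ) 1 = ∅ := by
      ext x
      simp only [mem_inter_iff, mem_Iic, mem_Icc, mem_empty_iff_false, iff_false]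
      intro h
      linarith [h.1, h.2.1]
    rw [h1, h2, measure_empty, measure_empty]
  rcases le_or_gt 1 u with hu1 | hu1
  · have h1 : cdf ν ⁻¹' Iic u = univ := by
      ext x
      simpa using (cdf_le_one ν x).trans hu1
    have h2 : Iic u ∩ Icc (0 : ℝ) 1 = Icc 0 1 :=
      inter_eq_right.2 fun x hx => hx.2.trans hu1
    rw [h1, h2, measure_univ, Real.volume_Icc]
    simp
  have h2 : Iic u ∩ Icc (0 : ℝ) 1 = Icc 0 u := by
    ext x
    simp only [mem_inter_iff, mem_Iic, mem_Icc]
    constructor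
    · exact fun h => ⟨h.2.1, h.1⟩
    · exact fun h => ⟨h.2, h.1, h.2.trans hu1.le⟩
  rw [h2, Real.volume_Icc, sub_zero]
  apply le_antisymm
  · refine ENNReal.le_of_forall_pos_le_add fun δ hδ _ => ?_
    have hex : ∃ a, u < cdf ν a ∧ cdf ν a < u + δ := by
      obtain ⟨w, hw1, hw2⟩ := exists_between (lt_min hu1 (lt_add_of_pos_right u
        (show (0 : ℝ) < δ from hδ)))
      obtain ⟨b, hb⟩ := ((tendsto_cdf_atBot ν).eventually_lt_const
        (hu0.trans_lt hw1)).exists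
      obtain ⟨c, hc'⟩ := ((tendsto_cdf_atTop ν).eventually_const_lt
        (hw2.trans_le (min_le_left _ _))).exists
      obtain ⟨a, ha⟩ := mem_range_of_exists_le_of_exists_ge hc ⟨b, hb.le⟩ ⟨c, hc'.le⟩
      exact ⟨a, by rw [ha]; exact hw1, by rw [ha]; exact hw2.trans_le (min_le_right _ _)⟩
    obtain ⟨a, ha1, ha2⟩ := hex
    calc ν (cdf ν ⁻¹' Iic u) ≤ ν (Iic a) := by
          refine measure_mono fun x hx => ?_
          by_contra hxa
          have := monotone_cdf ν (not_le.1 hxa).le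
          exact absurd hx (not_le.2 (ha1.trans_le this))
      _ = ENNReal.ofReal (cdf ν a) := (ofReal_cdf ν a).symm
      _ ≤ ENNReal.ofReal (u + δ) := ENNReal.ofReal_le_ofReal ha2.le
      _ = ENNReal.ofReal u + δ := by
          rw [ENNReal.ofReal_add hu0 δ.coe_nonneg, ENNReal.ofReal_coe_nnreal]
  · rcases hu0.eq_or_lt with rfl | hu0
    · simp
    obtain ⟨b, hb⟩ := ((tendsto_cdf_atBot ν).eventually_lt_const hu0).exists
    obtain ⟨c, hc'⟩ := ((tendsto_cdf_atTop ν).eventually_const_lt hu1).exists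
    obtain ⟨a, ha⟩ := mem_range_of_exists_le_of_exists_ge hc ⟨b, hb.le⟩ ⟨c, hc'.le⟩
    rw [← ha, ofReal_cdf]
    exact measure_mono fun x hx => monotone_cdf ν hx

open Set in
/-- If `U` is uniform on `[0, 1]`, this bounds the mean of the `n`-th power of the uniform mass of
`[U, U + q)`. -/
theorem lintegral_uniform_Ico_pow_le {q : ℝ} (hq0 : 0 ≤ q) (hq1 : q ≤ 1) (n : ℕ) :
    ∫⁻ u, (volume.restrict (Icc (0 : ℝ) 1) (Ico u (u + q))) ^ n ∂volume.restrict (Icc (0 : ℝ) 1) ≤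
      ENNReal.ofReal ((1 - q) * q ^ n + q ^ (n + 1) / (n + 1)) := by
  have hsplit : Icc (0 : ℝ) 1 = Icc 0 (1 - q) ∪ Ioc (1 - q) 1 :=
    (Icc_union_Ioc_eq_Icc (by linarith) (by linarith)).symm
  have hint : ∫ u in (1 - q)..1, (1 - u) ^ n = q ^ (n + 1) / (n + 1) := by
    rw [intervalIntegral.integral_comp_sub_left (fun x : ℝ => x ^ n) 1, integral_pow]
    simp
  calc _ ≤ (∫⁻ u in Icc (0 : ℝ) (1 - q), (volume.restrict (Icc (0 : ℝ) 1) (Ico u (u + q))) ^ n)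
        + ∫⁻ u in Ioc (1 - q) 1, (volume.restrict (Icc (0 : ℝ) 1) (Ico u (u + q))) ^ n := by
        refine le_trans (le_of_eq ?_) (lintegral_union_le _ _ _)
        rw [← hsplit]
    _ ≤ (∫⁻ _ in Icc (0 : ℝ) (1 - q), ENNReal.ofReal (q ^ n))
        + ∫⁻ u in Ioc (1 - q) 1, ENNReal.ofReal ((1 - u) ^ n) := by
        refine add_le_add (lintegral_mono fun u => ?_)
          (setLIntegral_mono (by fun_prop) fun u hu => ?_)
        · rw [ENNReal.ofReal_pow hq0]
          gcongr
          refine (Measure.restrict_apply_le _ _).trans ?_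
          rw [Real.volume_Ico]
          simp
        · rw [ENNReal.ofReal_pow (sub_nonneg.2 hu.2)]
          gcongr
          rw [Measure.restrict_apply measurableSet_Ico, ← Real.volume_Icc]
          exact measure_mono fun x hx => ⟨hx.1.1, hx.2.2⟩
    _ = _ := by
        rw [setLIntegral_const, Real.volume_Icc, ← ofReal_integral_eq_lintegral_ofReal,
          ← intervalIntegral.integral_of_le (by linarith), hint, ← ENNReal.ofReal_mul (by positivity),
          ← ENNReal.ofReal_add (mul_nonneg (by positivity) (by linarith)) (by positivity)]
        · congr 1
          ring
        · exact (Continuous.integrableOn_Icc (by fun_prop)).mono_set Ioc_subset_Icc_self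
        · exact (ae_restrict_iff' measurableSet_Ioc).2
            (Filter.Eventually.of_forall fun u hu => pow_nonneg (sub_nonneg.2 hu.2) n)

open Set in
/-- The probability that all of `n + 1` independent uniform variables on `[0, 1]` lie within `q`
above the `j`-th one. -/
theorem pi_uniform_forall_mem_Ico_le {q : ℝ} (hq0 : 0 ≤ q) (hq1 : q ≤ 1) (n : ℕ)
    (j : Fin (n + 1)) :
    (Measure.pi fun _ : Fin (n + 1) => volume.restrict (Icc (0 : ℝ) 1))
        {U | ∀ k, k ≠ j → U k ∈ Ico (U j) (U j + q)} ≤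
      ENNReal.ofReal ((1 - q) * q ^ n + q ^ (n + 1) / (n + 1)) := by
  set A : Set (ℝ × (Fin n → ℝ)) := {p | ∀ k, p.2 k ∈ Ico p.1 (p.1 + q)} with hA
  have hAm : MeasurableSet A := by
    have : A = ⋂ k, ({p | p.1 ≤ p.2 k} ∩ {p | p.2 k < p.1 + q}) := by
      ext p
      simp [hA]
    rw [this]
    exact MeasurableSet.iInter fun k =>
      (measurableSet_le (by fun_prop) (by fun_prop)).inter
        (measurableSet_lt (by fun_prop) (by fun_prop))
  have hpre : {U : Fin (n + 1) → ℝ | ∀ k, k ≠ j → U k ∈ Ico (U j) (U j + q)} =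
      MeasurableEquiv.piFinSuccAbove (fun _ => ℝ) j ⁻¹' A := by
    ext U
    simp only [hA, mem_ofPred_eq, mem_preimage]
    constructor
    · exact fun h k => h _ (Fin.succAbove_ne j k)
    · intro h k hk
      obtain ⟨l, rfl⟩ := Fin.exists_succAbove_eq hk
      exact h l
  rw [hpre, (measurePreserving_piFinSuccAbove
    (fun _ : Fin (n + 1) => volume.restrict (Icc (0 : ℝ) 1)) j).measure_preimage
      hAm.nullMeasurableSet, Measure.prod_apply hAm]
  refine le_trans (le_of_eq (lintegral_congr fun u => ?_)) (lintegral_uniform_Ico_pow_le hq0 hq1 n)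
  have : Prod.mk u ⁻¹' A = univ.pi fun _ : Fin n => Ico u (u + q) := by
    ext v
    simp [hA]
  rw [this, Measure.pi_pi]
  simp

open Set ProbabilityTheory in
/-- For `N` independent scenarios from an atomless law, the probability that some scenario
has all the others above it in distribution function, and by less than `q`. -/
theorem pi_exists_forall_cdf_mem_Ico_le {m N : ℕ} (hN : 1 ≤ N) (μ : Measure (Fin m → ℝ))
    [IsProbabilityMeasure μ] (i : Fin m) (hi : NullSingletonClass (μ.map fun s => s i))
    {q : ℝ} (hq0 : 0 ≤ q) (hq1 : q ≤ 1) :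
    (Measure.pi fun _ : Fin N => μ)
        {S | ∃ j, ∀ k, k ≠ j → cdf (μ.map fun s => s i) (S k i) ∈
          Ico (cdf (μ.map fun s => s i) (S j i)) (cdf (μ.map fun s => s i) (S j i) + q)} ≤
      ENNReal.ofReal (q ^ (N - 1) * (q + N * (1 - q))) := by
  obtain ⟨n, rfl⟩ : ∃ n, N = n + 1 := ⟨N - 1, by omega⟩
  have hproj : Measurable fun s : Fin m → ℝ => s i := measurable_pi_apply i
  have hprob : IsProbabilityMeasure (μ.map fun s => s i) :=
    Measure.isProbabilityMeasure_map hproj.aemeasurable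
  set ν := μ.map fun s => s i with hν
  set F := cdf ν
  have hF : Measurable F := (continuous_cdf_of_nullSingletonClass ν).measurable
  have hFi : Measurable fun s : Fin m → ℝ => F (s i) := hF.comp hproj
  have hmap : μ.map (fun s => F (s i)) = volume.restrict (Icc (0 : ℝ) 1) := by
    rw [← map_cdf_of_nullSingletonClass ν, hν, Measure.map_map hF hproj]
    rfl
  have hpi : (Measure.pi fun _ : Fin (n + 1) => μ).map (fun S j => F (S j i)) =
      Measure.pi fun _ : Fin (n + 1) => volume.restrict (Icc (0 : ℝ) 1) := by
    have : ∀ _ : Fin (n + 1), SigmaFinite (μ.map fun s => F (s i)) := fun _ => by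
      rw [hmap]; infer_instance
    rw [Measure.pi_map_pi (μ := fun _ : Fin (n + 1) => μ) (f := fun _ s => F (s i))
      fun _ => hFi.aemeasurable, hmap]
  have hmp : Measurable fun (S : Fin (n + 1) → Fin m → ℝ) j => F (S j i) :=
    measurable_pi_lambda _ fun j => hFi.comp (measurable_pi_apply j)
  have hbound (j : Fin (n + 1)) : (Measure.pi fun _ : Fin (n + 1) => μ)
      {S | ∀ k, k ≠ j → F (S k i) ∈ Ico (F (S j i)) (F (S j i) + q)} ≤
      ENNReal.ofReal ((1 - q) * q ^ n + q ^ (n + 1) / (n + 1)) := by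
    refine le_trans ?_ (pi_uniform_forall_mem_Ico_le hq0 hq1 n j)
    rw [← hpi]
    exact Measure.le_map_apply hmp.aemeasurable _
  have hnonneg : 0 ≤ (1 - q) * q ^ n + q ^ (n + 1) / (n + 1) :=
    add_nonneg (mul_nonneg (by linarith) (by positivity)) (by positivity)
  rw [show {S : Fin (n + 1) → Fin m → ℝ | ∃ j, ∀ k, k ≠ j → F (S k i) ∈
      Ico (F (S j i)) (F (S j i) + q)} =
      ⋃ j, {S | ∀ k, k ≠ j → F (S k i) ∈ Ico (F (S j i)) (F (S j i) + q)} by ext; simp]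
  refine (measure_iUnion_fintype_le _ _).trans ((Finset.sum_le_sum fun j _ => hbound j).trans ?_)
  rw [Finset.sum_const, Finset.card_univ, Fintype.card_fin, ← ENNReal.ofReal_nsmul]
  refine ENNReal.ofReal_le_ofReal (le_of_eq ?_)
  rw [nsmul_eq_mul, Nat.add_sub_cancel]
  push_cast
  field_simp
  ring

open Set ProbabilityTheory in
/-- If in every coordinate two scenarios enclose mass `1 - ε / m`, then the box hull has mass at
least `1 - ε`. -/
theorem ofReal_one_sub_le_measure_box {m N : ℕ} (hm : 1 ≤ m)
    (μ : Measure (Fin m → ℝ)) [IsProbabilityMeasure μ] {ε : ℝ} (hε0 : 0 ≤ ε)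
    (S : Fin N → Fin m → ℝ) {a b : Fin m → ℝ}
    (ha : ∀ i, ∃ j, S j i = a i) (haS : ∀ i j, a i ≤ S j i) (hbS : ∀ i j, S j i ≤ b i)
    (hS : ∀ i j, ∃ k, k ≠ j ∧ cdf (μ.map fun s => s i) (S k i) ∉
      Ico (cdf (μ.map fun s => s i) (S j i))
        (cdf (μ.map fun s => s i) (S j i) + (1 - ε / m))) :
    ENNReal.ofReal (1 - ε) ≤ μ {s | ∀ i, a i ≤ s i ∧ s i ≤ b i} := by
  have hm0 : (0 : ℝ) < m := by exact_mod_cast hm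
  have hcoord (i : Fin m) : μ {s | ¬(a i ≤ s i ∧ s i ≤ b i)} ≤ ENNReal.ofReal (ε / m) := by
    have hproj : Measurable fun s : Fin m → ℝ => s i := measurable_pi_apply i
    have hprob : IsProbabilityMeasure (μ.map fun s => s i) :=
      Measure.isProbabilityMeasure_map hproj.aemeasurable
    obtain ⟨j, hj⟩ := ha i
    obtain ⟨k, -, hk⟩ := hS i j
    have hjk : S j i ≤ S k i := hj ▸ haS i k
    have hmass : cdf (μ.map fun s => s i) (S j i) + (1 - ε / m) ≤
        cdf (μ.map fun s => s i) (S k i) := by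
      by_contra h
      exact hk ⟨monotone_cdf _ hjk, not_le.1 h⟩
    have hIoc : ENNReal.ofReal (1 - ε / m) ≤ (μ.map fun s => s i) (Icc (a i) (b i)) := by
      calc ENNReal.ofReal (1 - ε / m) ≤ ENNReal.ofReal
            (cdf (μ.map fun s => s i) (S k i) - cdf (μ.map fun s => s i) (S j i)) :=
            ENNReal.ofReal_le_ofReal (by linarith)
        _ = (μ.map fun s => s i) (Ioc (S j i) (S k i)) := by
            rw [← StieltjesFunction.measure_Ioc, measure_cdf]
        _ ≤ _ := measure_mono (t := Icc (a i) (b i)) fun x hx =>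
            ⟨hj ▸ hx.1.le, hx.2.trans (hbS i k)⟩
    have hset : {s : Fin m → ℝ | ¬(a i ≤ s i ∧ s i ≤ b i)} =
        (fun s : Fin m → ℝ => s i) ⁻¹' (Icc (a i) (b i))ᶜ := rfl
    rw [hset, ← Measure.map_apply hproj measurableSet_Icc.compl,
      prob_compl_eq_one_sub measurableSet_Icc]
    calc _ ≤ 1 - ENNReal.ofReal (1 - ε / m) := tsub_le_tsub_left hIoc 1
      _ ≤ _ := by
        rw [tsub_le_iff_right, ← ENNReal.ofReal_one]
        refine le_trans (ENNReal.ofReal_le_ofReal (le_of_eq ?_)) ENNReal.ofReal_add_le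
        ring
  have hcompl : μ {s | ∀ i, a i ≤ s i ∧ s i ≤ b i}ᶜ ≤ ENNReal.ofReal ε := by
    rw [show {s : Fin m → ℝ | ∀ i, a i ≤ s i ∧ s i ≤ b i}ᶜ =
      ⋃ i, {s | ¬(a i ≤ s i ∧ s i ≤ b i)} by ext; simp only [mem_compl_iff, mem_ofPred_eq,
        mem_iUnion, not_forall]]
    refine (measure_iUnion_fintype_le _ _).trans ((Finset.sum_le_sum fun i _ => hcoord i).trans ?_)
    rw [Finset.sum_const, Finset.card_univ, Fintype.card_fin, ← ENNReal.ofReal_nsmul, nsmul_eq_mul,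
      mul_div_cancel₀ _ hm0.ne']
  exact ofReal_one_sub_le_of_measure_compl_le μ hε0 hcompl

/-- The real inequality behind the sample size: the failure probabilities of the `m`
coordinates sum to at most `β`. -/
theorem mul_pow_mul_le_of_sampleSize_le {m : ℕ} (hm : 1 ≤ m) {ε β : ℝ} (hε0 : 0 < ε)
    (hε1 : ε < 1) (hβ0 : 0 < β) (Nstar : ℕ)
    (hNstar : Nstar =
      ⌈((m : ℝ) / ε) * (Real.exp 1 / (Real.exp 1 - 1)) *
        (1 + Real.log ((m : ℝ) / β))⌉₊)
    {N : ℕ} (hN1 : 1 ≤ N)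
    (hN : (Real.log β - Real.log ((m : ℝ) - ε + (Nstar : ℝ) * ε)) /
        Real.log (1 - ε / (m : ℝ)) + 1 ≤ (N : ℝ)) :
    m * ((1 - ε / m) ^ (N - 1) * ((1 - ε / m) + N * (1 - (1 - ε / m)))) ≤ β := by
  have hm1 : (1 : ℝ) ≤ m := by exact_mod_cast hm
  have hm0 : (0 : ℝ) < m := by linarith
  have hp0 : 0 < ε / m := by positivity
  have hp1 : ε / m < 1 := (div_lt_one hm0).2 (by linarith)
  have hq0 : 0 < 1 - ε / m := by linarith
  obtain ⟨n, rfl⟩ : ∃ n, N = n + 1 := ⟨N - 1, by omega⟩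
  rw [Nat.add_sub_cancel]
  rcases le_total (n + 1) Nstar with hle | hle
  · have hc0 : 0 < (m : ℝ) - ε + Nstar * ε := by
      have : 0 ≤ (Nstar : ℝ) * ε := by positivity
      linarith
    have hlog : Real.log (1 - ε / m) < 0 := Real.log_neg hq0 (by linarith)
    have h1 : (Real.log β - Real.log ((m : ℝ) - ε + Nstar * ε)) / Real.log (1 - ε / m) ≤ n := by
      push_cast at hN
      linarith
    rw [div_le_iff_of_neg hlog] at h1
    have h2 : (1 - ε / m) ^ n * ((m : ℝ) - ε + Nstar * ε) ≤ β := by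
      rw [← Real.log_le_log_iff (by positivity) hβ0, Real.log_mul (by positivity) hc0.ne',
        Real.log_pow]
      linarith
    have h3 : ((n + 1 : ℕ) : ℝ) ≤ Nstar := by exact_mod_cast hle
    calc _ = (1 - ε / m) ^ n * ((m : ℝ) - ε + (n + 1 : ℕ) * ε) := by field_simp; ring
      _ ≤ (1 - ε / m) ^ n * ((m : ℝ) - ε + Nstar * ε) := by gcongr
      _ ≤ β := h2
  · have he : 1 < Real.exp 1 := Real.one_lt_exp_iff.2 one_pos
    set c := Real.exp (-1) with hc
    have hc0 : 0 < c := Real.exp_pos _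
    have hc1 : c ≤ 1 := Real.exp_le_one_iff.2 (by norm_num)
    have hce : c * Real.exp 1 = 1 := by rw [hc, ← Real.exp_add]; simp
    set q := 1 - ε / m with hq
    have hsize : 1 + Real.log (m / β) ≤ (n + 1 : ℕ) * ((1 - q) * (1 - c)) := by
      have h1 : (m : ℝ) / ε * (Real.exp 1 / (Real.exp 1 - 1)) * (1 + Real.log (m / β)) ≤
          (n + 1 : ℕ) :=
        (Nat.le_ceil _).trans (by rw [← hNstar]; exact_mod_cast hle)
      have h2 : (1 - q) * (1 - c) * ((m : ℝ) / ε * (Real.exp 1 / (Real.exp 1 - 1))) = 1 := by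
        have h3 : (1 - c) * Real.exp 1 = Real.exp 1 - 1 := by linear_combination -hce
        have h4 : Real.exp 1 - 1 ≠ 0 := by linarith
        have h5 : (1 - q) * (m / ε) = 1 := by rw [hq]; field_simp; ring
        calc _ = (1 - q) * (m / ε) * (((1 - c) * Real.exp 1) / (Real.exp 1 - 1)) := by ring
          _ = 1 := by rw [h5, h3, div_self h4, one_mul]
      have h6 : 0 ≤ (1 - q) * (1 - c) := mul_nonneg (by linarith) (by linarith)
      calc _ = (1 - q) * (1 - c) * ((m : ℝ) / ε * (Real.exp 1 / (Real.exp 1 - 1))) *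
            (1 + Real.log (m / β)) := by rw [h2, one_mul]
        _ ≤ _ := by nlinarith [mul_le_mul_of_nonneg_left h1 h6]
    have hbern : c * (q ^ n * (q + (n + 1 : ℕ) * (1 - q))) ≤ (q + (1 - q) * c) ^ (n + 1) := by
      have h1 : 1 + ((n + 1 : ℕ) : ℝ) * ((1 - q) * c / q) ≤ (1 + (1 - q) * c / q) ^ (n + 1) :=
        one_add_mul_le_pow (by
          have : 0 ≤ (1 - q) * c / q := div_nonneg (mul_nonneg (by linarith) hc0.le) hq0.le
          linarith) _
      have h2 : (q + (1 - q) * c) ^ (n + 1) = q ^ (n + 1) * (1 + (1 - q) * c / q) ^ (n + 1) := by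
        rw [← mul_pow]
        congr 1
        field_simp
      rw [h2]
      refine le_trans ?_ (mul_le_mul_of_nonneg_left h1 (by positivity))
      have h3 : q ^ (n + 1) * (1 + ((n + 1 : ℕ) : ℝ) * ((1 - q) * c / q)) =
          q ^ n * (q + (n + 1 : ℕ) * ((1 - q) * c)) := by
        field_simp
        ring
      rw [h3, mul_left_comm]
      gcongr
      nlinarith
    have hexp : (q + (1 - q) * c) ^ (n + 1) ≤ c * (β / m) := by
      calc (q + (1 - q) * c) ^ (n + 1)
          ≤ Real.exp (-((1 - q) * (1 - c))) ^ (n + 1) := by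
            refine pow_le_pow_left₀ (add_nonneg hq0.le (mul_nonneg (by linarith) hc0.le)) ?_ _
            linarith [Real.add_one_le_exp (-((1 - q) * (1 - c)))]
        _ = Real.exp (-((n + 1 : ℕ) * ((1 - q) * (1 - c)))) := by
            rw [← Real.exp_nat_mul]
            congr 1
            ring
        _ ≤ Real.exp (-1 + Real.log (β / m)) := by
            apply Real.exp_le_exp.2
            rw [← inv_div, Real.log_inv]
            linarith
        _ = c * (β / m) := by rw [Real.exp_add, Real.exp_log (by positivity)]
    have h := le_of_mul_le_mul_left (hbern.trans hexp) hc0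
    calc _ ≤ m * (β / m) := by gcongr
      _ = β := mul_div_cancel₀ _ hm0.ne'

theorem probabilistic_guarantee_multi_dim {m : ℕ} (hm : 1 ≤ m)
    (μ : Measure (Fin m → ℝ)) [IsProbabilityMeasure μ]
    (hmarg : ∀ i : Fin m, NoAtoms (μ.map fun s => s i))
    {ε β : ℝ} (hε0 : 0 < ε) (hε1 : ε < 1) (hβ0 : 0 < β) (hβ1 : β < 1)
    (Nstar : ℕ)
    (hNstar : Nstar =
      ⌈((m : ℝ) / ε) * (Real.exp 1 / (Real.exp 1 - 1)) *
        (1 + Real.log ((m : ℝ) / β))⌉₊)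
    {N : ℕ} (hN1 : 1 ≤ N)
    (hN : (Real.log β - Real.log ((m : ℝ) - ε + (Nstar : ℝ) * ε)) /
        Real.log (1 - ε / (m : ℝ)) + 1 ≤ (N : ℝ)) :
    ENNReal.ofReal (1 - β) ≤
      (Measure.pi fun _ : Fin N => μ)
        {S : Fin N → (Fin m → ℝ) | ENNReal.ofReal (1 - ε) ≤
          μ {s : Fin m → ℝ | ∀ i : Fin m,
            (Finset.inf' Finset.univ (Finset.univ_nonempty_iff.mpr ⟨⟨0, hN1⟩⟩)
                fun j => S j i) ≤ s i ∧
            s i ≤ Finset.sup' Finset.univ (Finset.univ_nonempty_iff.mpr ⟨⟨0, hN1⟩⟩)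
                fun j => S j i}} := by
  have hm0 : (0 : ℝ) < m := by exact_mod_cast hm
  have hp1 : ε / m ≤ 1 := (div_le_one hm0).2 (hε1.le.trans (by exact_mod_cast hm))
  have hp0 : 0 < ε / m := by positivity
  apply ofReal_one_sub_le_of_measure_compl_le _ hβ0.le
  refine (measure_mono (t := ⋃ i : Fin m, {S : Fin N → Fin m → ℝ | ∃ j, ∀ k, k ≠ j →
    ProbabilityTheory.cdf (μ.map fun s => s i) (S k i) ∈
      Set.Ico (ProbabilityTheory.cdf (μ.map fun s => s i) (S j i))
        (ProbabilityTheory.cdf (μ.map fun s => s i) (S j i) + (1 - ε / m))}) ?_).trans ?_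
  · rw [Set.compl_subset_comm]
    intro S hS
    simp only [Set.mem_compl_iff, Set.mem_iUnion, Set.mem_ofPred_eq, not_exists, not_forall] at hS
    refine ofReal_one_sub_le_measure_box hm μ hε0.le S (fun i => ?_)
      (fun i j => Finset.inf'_le _ (Finset.mem_univ j))
      (fun i j => Finset.le_sup' (fun j => S j i) (Finset.mem_univ j)) ?_
    · obtain ⟨j, -, hj⟩ := Finset.exists_mem_eq_inf'
        (Finset.univ_nonempty_iff.mpr ⟨(⟨0, hN1⟩ : Fin N)⟩) fun j => S j i
      exact ⟨j, hj.symm⟩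
    · intro i j
      obtain ⟨k, hkj, hk⟩ := hS i j
      exact ⟨k, hkj, hk⟩
  · refine (measure_iUnion_fintype_le _ _).trans ((Finset.sum_le_sum fun i _ =>
      pi_exists_forall_cdf_mem_Ico_le hN1 μ i (hmarg i) (by linarith) (by linarith)).trans ?_)
    rw [Finset.sum_const, Finset.card_univ, Fintype.card_fin, ← ENNReal.ofReal_nsmul, nsmul_eq_mul]
    exact ENNReal.ofReal_le_ofReal
      (mul_pow_mul_le_of_sampleSize_le hm hε0 hε1 hβ0 Nstar hNstar hN1 hN)
end

section
/- Let m ≥ 1, let μ be a Borel probability measure on ℝ^m, let 0 < ε < 1 and 0 < β < 1, and let N ≥ 1 be a natural number with N ≥ ⌈ (1/ε) · (e/(e−1)) · (2m − 1 + ln(1/β)) ⌉. Then, under the N-fold product measure μ^{⊗N} on (ℝ^m)^N, the probability of the event { (s_1,…,s_N) : μ( { s ∈ ℝ^m : min_{j∈[N]} s_j^i ≤ s^i ≤ max_{j∈[N]} s_j^i for every i ∈ [m] } ) ≥ 1 − ε } is at least 1 − β. -/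
open MeasureTheory

/-- A chain of sublevel sets of `g`, each of measure less than `c`, has union of measure at most
`c`. -/
lemma measure_setOf_sublevel_lt_le {Ω : Type*} [MeasurableSpace Ω] (ν : Measure Ω)
    (g : Ω → ℝ) (c : ENNReal) :
    ν {x | ν {y | g y ≤ g x} < c} ≤ c := by
  set D : Set ℝ := {t | ν {y | g y ≤ t} < c} with hD
  have hlower : ∀ {s t : ℝ}, s ≤ t → t ∈ D → s ∈ D := fun hst ht =>
    lt_of_le_of_lt (measure_mono fun y (hy : g y ≤ _) => hy.trans hst) ht
  change ν {x | g x ∈ D} ≤ c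
  by_cases hmax : ∃ t ∈ D, ∀ s ∈ D, s ≤ t
  · obtain ⟨t, ht, hmax⟩ := hmax
    exact (measure_mono fun x (hx : g x ∈ D) => hmax _ hx).trans (le_of_lt ht)
  · push Not at hmax
    have hsub : {x | g x ∈ D} ⊆ ⋃ r : {r : ℚ // (r : ℝ) ∈ D}, {y | g y ≤ ((r : ℚ) : ℝ)} := by
      intro x hx
      obtain ⟨s, hs, hlt⟩ := hmax _ hx
      obtain ⟨r, hr1, hr2⟩ := exists_rat_btwn hlt
      exact Set.mem_iUnion.mpr ⟨⟨r, hlower hr2.le hs⟩, hr1.le⟩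
    have hmono : Monotone fun r : {r : ℚ // (r : ℝ) ∈ D} => {y | g y ≤ ((r : ℚ) : ℝ)} := by
      intro r s hrs y (hy : g y ≤ _)
      exact hy.trans (by exact_mod_cast hrs)
    refine (measure_mono hsub).trans ?_
    rw [hmono.directed_le.measure_iUnion]
    exact iSup_le fun r => le_of_lt r.2

section Hull

variable {Ω ι J : Type*} [MeasurableSpace Ω]

/-- The points lying below at least one of the scenarios `a` with respect to each of the
functions `f k`. -/
def lowerHull (f : ι → Ω → ℝ) (a : J → Ω) : Set Ω :=
  {x | ∀ k, ∃ j, f k x ≤ f k (a j)}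

/-- The points of the hull of `a` below whose `g`-level the hull has measure less than `c`. -/
def lightPart (μ : Measure Ω) (f : ι → Ω → ℝ) (g : Ω → ℝ) (c : ENNReal) (a : J → Ω) : Set Ω :=
  {x | x ∈ lowerHull f a ∧ μ {y | y ∈ lowerHull f a ∧ g y ≤ g x} < c}

lemma measurableSet_lowerHull_prod [Countable ι] [Countable J] {f : ι → Ω → ℝ}
    (hf : ∀ k, Measurable (f k)) :
    MeasurableSet {p : (J → Ω) × Ω | p.2 ∈ lowerHull f p.1} := by
  have hset : {p : (J → Ω) × Ω | p.2 ∈ lowerHull f p.1} =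
      ⋂ k, ⋃ j, {p : (J → Ω) × Ω | f k p.2 ≤ f k (p.1 j)} := by
    ext p
    simp [lowerHull]
  rw [hset]
  refine MeasurableSet.iInter fun k => MeasurableSet.iUnion fun j => ?_
  exact measurableSet_le ((hf k).comp measurable_snd)
    ((hf k).comp ((measurable_pi_apply j).comp measurable_fst))

lemma measurableSet_lowerHull [Countable ι] [Countable J] {f : ι → Ω → ℝ}
    (hf : ∀ k, Measurable (f k)) (a : J → Ω) : MeasurableSet (lowerHull f a) :=
  measurable_prodMk_left (measurableSet_lowerHull_prod hf)

lemma measurableSet_lightPart_prod [Countable ι] [Countable J] (μ : Measure Ω) [SFinite μ]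
    {f : ι → Ω → ℝ} (hf : ∀ k, Measurable (f k)) {g : Ω → ℝ} (hg : Measurable g)
    (c : ENNReal) :
    MeasurableSet {p : (J → Ω) × Ω | p.2 ∈ lightPart μ f g c p.1} := by
  have hset : MeasurableSet {z : ((J → Ω) × Ω) × Ω |
      z.2 ∈ lowerHull f z.1.1 ∧ g z.2 ≤ g z.1.2} := by
    refine MeasurableSet.inter ?_ ?_
    · have hmap : Measurable fun z : ((J → Ω) × Ω) × Ω => (z.1.1, z.2) := by fun_prop
      exact hmap (measurableSet_lowerHull_prod hf)
    · exact measurableSet_le (hg.comp measurable_snd)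
        (hg.comp (measurable_snd.comp measurable_fst))
  exact (measurableSet_lowerHull_prod hf).inter
    (measurableSet_lt (measurable_measure_prodMk_left hset) measurable_const)

lemma measure_lightPart_le [Countable ι] [Countable J] (μ : Measure Ω) {f : ι → Ω → ℝ}
    (hf : ∀ k, Measurable (f k)) {g : Ω → ℝ} (hg : Measurable g) (c : ENNReal) (a : J → Ω) :
    μ (lightPart μ f g c a) ≤ c := by
  have hA := measurableSet_lowerHull hf a
  have hrestrict : ∀ t : ℝ, μ.restrict (lowerHull f a) {y | g y ≤ t} =
      μ {y | y ∈ lowerHull f a ∧ g y ≤ t} := fun t => by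
    rw [Measure.restrict_apply (measurableSet_le hg measurable_const), Set.inter_comm]
    rfl
  have h := measure_setOf_sublevel_lt_le (μ.restrict (lowerHull f a)) g c
  rw [Measure.restrict_apply' hA] at h
  simp only [hrestrict] at h
  refine le_trans (measure_mono ?_) h
  exact fun x hx => ⟨hx.2, hx.1⟩

/-- Given the scenarios indexed by `T`, all remaining ones fall in the light part of the hull. -/
def lightEvent (μ : Measure Ω) (f : ι → Ω → ℝ) (g : Ω → ℝ) (c : ENNReal) (T : Finset J) :
    Set (J → Ω) :=
  {S | ∀ j : {j // j ∉ T}, S j ∈ lightPart μ f g c fun i : {i // i ∈ T} => S i}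

/-- If the scenarios indexed by `T` already contain maximizers of every `f k`, a scenario family
with a hull of measure less than `c` belongs to the light event of `T`. -/
lemma mem_lightEvent_of_isMax (μ : Measure Ω) {f : ι → Ω → ℝ} {g : Ω → ℝ}
    {c : ENNReal} {S : J → Ω}
    (hS : μ {x | x ∈ lowerHull f S ∧ ∃ j, g x ≤ g (S j)} < c) {T : Finset J} {I : ι → J}
    (hI : ∀ k j, f k (S j) ≤ f k (S (I k))) (hT : ∀ k, I k ∈ T) :
    S ∈ lightEvent μ f g c T := by
  intro j
  refine ⟨fun k => ⟨⟨I k, hT k⟩, hI k j⟩, lt_of_le_of_lt (measure_mono ?_) hS⟩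
  rintro y ⟨hy, hgy⟩
  exact ⟨fun k => (hy k).imp' Subtype.val fun _ hi => hi, j, hgy⟩

variable [Fintype J]

lemma measurableSet_lightEvent_prod [Countable ι] (μ : Measure Ω) [SFinite μ]
    {f : ι → Ω → ℝ} (hf : ∀ k, Measurable (f k)) {g : Ω → ℝ} (hg : Measurable g)
    (c : ENNReal) (T : Finset J) :
    MeasurableSet {p : ({i // i ∈ T} → Ω) × ({i // i ∉ T} → Ω) |
      ∀ j, p.2 j ∈ lightPart μ f g c p.1} := by
  rw [Set.ofPred_forall]
  refine MeasurableSet.iInter fun j => ?_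
  have hmap : Measurable fun p : ({i // i ∈ T} → Ω) × ({i // i ∉ T} → Ω) =>
      (p.1, p.2 j) := by fun_prop
  exact hmap (measurableSet_lightPart_prod μ hf hg c)

lemma measurableSet_lightEvent [Countable ι] (μ : Measure Ω) [SFinite μ]
    {f : ι → Ω → ℝ} (hf : ∀ k, Measurable (f k)) {g : Ω → ℝ} (hg : Measurable g)
    (c : ENNReal) (T : Finset J) : MeasurableSet (lightEvent μ f g c T) := by
  classical
  exact (MeasurableEquiv.piEquivPiSubtypeProd (fun _ : J => Ω) (· ∈ T)).measurable
    (measurableSet_lightEvent_prod μ hf hg c T)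

lemma measure_lightEvent_le [Countable ι] (μ : Measure Ω) [IsProbabilityMeasure μ]
    {f : ι → Ω → ℝ} (hf : ∀ k, Measurable (f k)) {g : Ω → ℝ} (hg : Measurable g)
    (c : ENNReal) (T : Finset J) :
    (Measure.pi fun _ : J => μ) (lightEvent μ f g c T) ≤ c ^ (Fintype.card J - T.card) := by
  classical
  have hmeas := measurableSet_lightEvent_prod μ hf hg c T
  have hpre : lightEvent μ f g c T =
      MeasurableEquiv.piEquivPiSubtypeProd (fun _ : J => Ω) (· ∈ T) ⁻¹'
        {p | ∀ j, p.2 j ∈ lightPart μ f g c p.1} := rfl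
  rw [hpre, (measurePreserving_piEquivPiSubtypeProd (fun _ : J => μ) (· ∈ T)).measure_preimage
    hmeas.nullMeasurableSet, Measure.prod_apply hmeas]
  have hcard : Fintype.card {j // j ∉ T} = Fintype.card J - T.card := by
    rw [Fintype.card_subtype_compl, Fintype.card_coe]
  refine (lintegral_mono (g := fun _ => c ^ (Fintype.card J - T.card)) fun a => ?_).trans
    (by simp)
  have hbox : Prod.mk a ⁻¹' {p : ({i // i ∈ T} → Ω) × ({i // i ∉ T} → Ω) |
      ∀ j, p.2 j ∈ lightPart μ f g c p.1} =
      Set.univ.pi fun _ => lightPart μ f g c a := by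
    ext b
    simp
  rw [hbox, Measure.pi_pi, Finset.prod_const, Finset.card_univ, hcard]
  exact pow_le_pow_left' (measure_lightPart_le μ hf hg c a) _

/-- The weights of the subsets containing a fixed set `I` under independent thinning. -/
lemma pow_card_le_sum_superset [DecidableEq J] {a b : ENNReal} (hab : a + b = 1) (I : Finset J) :
    a ^ I.card ≤ ∑ T : Finset J, if I ⊆ T then a ^ T.card * b ^ (Fintype.card J - T.card)
      else 0 := by
  have h := Finset.prod_add (fun _ : J => a) (fun i => if i ∈ I then 0 else b) Finset.univ
  have hl : ∏ i : J, (a + if i ∈ I then 0 else b) = a ^ I.card := by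
    have : ∀ i : J, (a + if i ∈ I then 0 else b) = if i ∈ I then a else 1 := by
      intro i
      split_ifs <;> simp [hab]
    simp [this]
  rw [← hl, h, Finset.powerset_univ]
  refine Finset.sum_le_sum fun T _ => ?_
  split_ifs with hIT
  · rw [Finset.prod_const]
    gcongr
    rw [← Finset.card_univ, ← Finset.card_sdiff_of_subset (Finset.subset_univ T),
      ← Finset.prod_const]
    exact Finset.prod_le_prod' fun i _ => by split_ifs <;> simp
  · obtain ⟨i, hi, hiT⟩ := Finset.not_subset.mp hIT
    refine le_of_eq (mul_eq_zero_of_right _ ?_)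
    exact Finset.prod_eq_zero (i := i) (by simp [hiT]) (by simp [hi])

/-- Tail bound for the measure of the hull of independent scenarios, by random thinning. -/
theorem pow_card_mul_measure_hull_lt_le [Fintype ι] [Nonempty J] (μ : Measure Ω)
    [IsProbabilityMeasure μ] {f : ι → Ω → ℝ} (hf : ∀ k, Measurable (f k)) {g : Ω → ℝ}
    (hg : Measurable g) (c : ENNReal) {a b : ENNReal} (hab : a + b = 1) :
    a ^ Fintype.card ι * (Measure.pi fun _ : J => μ)
        {S | μ {x | x ∈ lowerHull f S ∧ ∃ j, g x ≤ g (S j)} < c} ≤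
      (a + b * c) ^ Fintype.card J := by
  classical
  set w : Finset J → ENNReal := fun T => a ^ T.card * b ^ (Fintype.card J - T.card)
  set F : (J → Ω) → ENNReal := fun S =>
    ∑ T : Finset J, (lightEvent μ f g c T).indicator (fun _ => w T) S
  have hind : ∀ T : Finset J, Measurable ((lightEvent μ f g c T).indicator fun _ => w T) :=
    fun T => measurable_const.indicator (measurableSet_lightEvent μ hf hg c T)
  have hF : Measurable F := Finset.measurable_sum _ fun T _ => hind T
  have ha1 : a ≤ 1 := hab ▸ le_self_add
  have hbad : {S : J → Ω | μ {x | x ∈ lowerHull f S ∧ ∃ j, g x ≤ g (S j)} < c} ⊆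
      {S | a ^ Fintype.card ι ≤ F S} := by
    intro S hS
    choose I hI using fun k => Finite.exists_max fun j => f k (S j)
    calc a ^ Fintype.card ι ≤ a ^ (Finset.univ.image I).card :=
          pow_le_pow_right_of_le_one' ha1 Finset.card_image_le
      _ ≤ _ := pow_card_le_sum_superset hab _
      _ ≤ F S := by
          refine Finset.sum_le_sum fun T _ => ?_
          split_ifs with hIT
          · rw [Set.indicator_of_mem (mem_lightEvent_of_isMax μ hS hI fun k =>
              hIT (Finset.mem_image_of_mem I (Finset.mem_univ k)))]
          · exact zero_le
  calc _ ≤ a ^ Fintype.card ι * (Measure.pi fun _ : J => μ) {S | a ^ Fintype.card ι ≤ F S} := by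
        gcongr
    _ ≤ ∫⁻ S, F S ∂(Measure.pi fun _ : J => μ) := mul_meas_ge_le_lintegral hF _
    _ = ∑ T, w T * (Measure.pi fun _ : J => μ) (lightEvent μ f g c T) := by
        rw [lintegral_finsetSum _ fun T _ => hind T]
        exact Finset.sum_congr rfl fun T _ =>
          lintegral_indicator_const (measurableSet_lightEvent μ hf hg c T) _
    _ ≤ ∑ T : Finset J, a ^ T.card * (b * c) ^ (Fintype.card J - T.card) := by
        refine Finset.sum_le_sum fun T _ => ?_
        rw [mul_pow, ← mul_assoc]
        gcongr
        exact measure_lightEvent_le μ hf hg c T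
    _ = _ := Fintype.sum_pow_mul_eq_add_pow J a (b * c)

end Hull

/-- The Chernoff-type estimate behind the explicit sample size. -/
lemma thinning_pow_le {ε β d : ℝ} (hε0 : 0 < ε) (hε1 : ε < 1) (hβ0 : 0 < β) {N : ℕ}
    (hN : (1 / ε) * (Real.exp 1 / (Real.exp 1 - 1)) * (d + Real.log (1 / β)) ≤ N) :
    (Real.exp (-1) + (1 - Real.exp (-1)) * (1 - ε)) ^ N ≤ Real.exp (-d) * β := by
  have he : 1 < Real.exp 1 := Real.one_lt_exp_iff.mpr one_pos
  have hq : Real.exp (-1) < 1 := Real.exp_lt_one_iff.mpr (by norm_num)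
  have hq0 := Real.exp_pos (-1)
  have hqe : 1 - Real.exp (-1) = (Real.exp 1 - 1) / Real.exp 1 := by
    rw [Real.exp_neg]
    field_simp
  have hexp : d + Real.log (1 / β) ≤ ε * (1 - Real.exp (-1)) * N := by
    have h := mul_le_mul_of_nonneg_left hN
      (mul_nonneg hε0.le (sub_nonneg.mpr hq.le))
    refine le_trans (le_of_eq ?_) h
    rw [hqe]
    have : Real.exp 1 - 1 ≠ 0 := by linarith
    field_simp
  calc _ ≤ Real.exp (-(ε * (1 - Real.exp (-1)))) ^ N := by
        refine pow_le_pow_left₀ (by nlinarith) ?_ _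
        have := Real.add_one_le_exp (-(ε * (1 - Real.exp (-1))))
        linarith
    _ = Real.exp (-(ε * (1 - Real.exp (-1)) * N)) := by
        rw [← Real.exp_nat_mul]
        ring_nf
    _ ≤ Real.exp (-d + Real.log β) := by
        rw [Real.exp_le_exp]
        rw [one_div, Real.log_inv] at hexp
        linarith
    _ = _ := by rw [Real.exp_add, Real.exp_log hβ0]

theorem margellos_guarantee_multi_dim {m : ℕ} (hm : 1 ≤ m)
    (μ : Measure (Fin m → ℝ)) [IsProbabilityMeasure μ]
    {ε β : ℝ} (hε0 : 0 < ε) (hε1 : ε < 1) (hβ0 : 0 < β) (hβ1 : β < 1)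
    {N : ℕ} (hN1 : 1 ≤ N)
    (hN : ⌈(1 / ε) * (Real.exp 1 / (Real.exp 1 - 1)) *
        (2 * (m : ℝ) - 1 + Real.log (1 / β))⌉₊ ≤ N) :
    ENNReal.ofReal (1 - β) ≤
      (Measure.pi fun _ : Fin N => μ)
        {S : Fin N → (Fin m → ℝ) | ENNReal.ofReal (1 - ε) ≤
          μ {s : Fin m → ℝ | ∀ i : Fin m,
            (Finset.inf' Finset.univ (Finset.univ_nonempty_iff.mpr ⟨⟨0, hN1⟩⟩)
                fun j => S j i) ≤ s i ∧
            s i ≤ Finset.sup' Finset.univ (Finset.univ_nonempty_iff.mpr ⟨⟨0, hN1⟩⟩)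
                fun j => S j i}} := by
  classical
  have : Nonempty (Fin N) := ⟨⟨0, hN1⟩⟩
  let face : Fin m ⊕ Fin m → (Fin m → ℝ) → ℝ := Sum.elim (fun i x => x i) (fun i x => -x i)
  have hface : ∀ k, Measurable (face k) := by
    rintro (i | i)
    · exact measurable_pi_apply i
    · exact (measurable_pi_apply i).neg
  let k₀ : Fin m ⊕ Fin m := Sum.inl ⟨0, hm⟩
  let f : {k // k ≠ k₀} → (Fin m → ℝ) → ℝ := fun k => face k
  have hcard : Fintype.card {k : Fin m ⊕ Fin m // k ≠ k₀} = 2 * m - 1 := by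
    rw [Fintype.card_subtype_compl, Fintype.card_subtype_eq]
    simp
    omega
  have hhull : ∀ S : Fin N → Fin m → ℝ,
      {x | x ∈ lowerHull f S ∧ ∃ j, face k₀ x ≤ face k₀ (S j)} =
      {s : Fin m → ℝ | ∀ i : Fin m,
        (Finset.inf' Finset.univ (Finset.univ_nonempty_iff.mpr ⟨⟨0, hN1⟩⟩)
            fun j => S j i) ≤ s i ∧
        s i ≤ Finset.sup' Finset.univ (Finset.univ_nonempty_iff.mpr ⟨⟨0, hN1⟩⟩)
            fun j => S j i} := by
    intro S
    ext x
    have hall : (x ∈ lowerHull f S ∧ ∃ j, face k₀ x ≤ face k₀ (S j)) ↔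
        ∀ k, ∃ j, face k x ≤ face k (S j) := by
      refine ⟨fun ⟨h, h₀⟩ k => ?_, fun h => ⟨fun k => h k, h k₀⟩⟩
      by_cases hk : k = k₀
      · exact hk ▸ h₀
      · exact h ⟨k, hk⟩
    simp [hall, face, Finset.inf'_le_iff, Finset.le_sup'_iff, forall_and, and_comm]
  have hq : Real.exp (-1) < 1 := Real.exp_lt_one_iff.mpr (by norm_num)
  have hq0 := Real.exp_pos (-1)
  have htail := pow_card_mul_measure_hull_lt_le (J := Fin N) μ (f := f) (fun k => hface k)
    (hface k₀) (ENNReal.ofReal (1 - ε))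
    (a := ENNReal.ofReal (Real.exp (-1))) (b := ENNReal.ofReal (1 - Real.exp (-1)))
    (by rw [← ENNReal.ofReal_add hq0.le (by linarith)]; simp)
  have hpow : Real.exp (-(2 * (m : ℝ) - 1)) = Real.exp (-1) ^ (2 * m - 1) := by
    rw [← Real.exp_nat_mul, Nat.cast_sub (by omega)]
    push_cast
    ring_nf
  have hbound := thinning_pow_le hε0 hε1 hβ0 (Nat.ceil_le.mp hN)
  rw [hcard, Fintype.card_fin, ← ENNReal.ofReal_mul (by linarith),
    ← ENNReal.ofReal_add hq0.le (mul_nonneg (by linarith) (by linarith)),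
    ← ENNReal.ofReal_pow (add_nonneg hq0.le (mul_nonneg (by linarith) (by linarith))),
    ← ENNReal.ofReal_pow hq0.le, ← hpow] at htail
  have hbad := htail.trans (ENNReal.ofReal_le_ofReal hbound)
  rw [ENNReal.ofReal_mul (Real.exp_pos _).le,
    ENNReal.mul_le_mul_iff_right (by simp [Real.exp_pos]) ENNReal.ofReal_ne_top] at hbad
  simp only [hhull] at hbad
  rw [ENNReal.ofReal_sub _ hβ0.le, ENNReal.ofReal_one, tsub_le_iff_right]
  refine le_trans ?_ (add_le_add_right hbad _)
  refine le_trans ?_ (measure_union_le _ _)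
  rw [← measure_univ (μ := Measure.pi fun _ : Fin N => μ)]
  refine measure_mono fun S _ => ?_
  simp only [Set.mem_union, Set.mem_ofPred_eq]
  exact le_or_gt _ _
end
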